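/- arXiv:1905.10516 — 2 statements merged into one kernel-verified Lean document; each statement's English description precedes it below -/
import Mathlib

section
/- For every integer d ≥ 3, every real α with 0 ≤ α ≤ d, every convex body B in ℝ^d, and every finite family λ_1,…,λ_k ∈ (0,1), x_1,…,x_k ∈ ℝ^d with B ⊆ ⋃_i (λ_i • B + x_i), one has ∑_{i=1}^k λ_i^α ≥ d − ⌈α⌉ (ln d)^2. In particular g_α(d) ≥ d − ⌈α⌉ (ln d)^2. -/
open Set MeasureTheory Pointwise

/-- A convex body: a compact convex set with nonempty interior. -/
def IsConvexBody {E : Type*} [NormedAddCommGroup E] [NormedSpace ℝ E] (B : Set E) : Prop :=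
  Convex ℝ B ∧ IsCompact B ∧ (interior B).Nonempty

/-- `gCov α B` is the infimum of `∑ λᵢ^α` over all finite translative coverings of `B`
by homothets `xᵢ + λᵢ • B` with `λᵢ ∈ (0,1)`. -/
noncomputable def gCov {E : Type*} [NormedAddCommGroup E] [NormedSpace ℝ E]
    (α : ℝ) (B : Set E) : ℝ :=
  sInf {s : ℝ | ∃ (k : ℕ) (lam : Fin k → ℝ) (x : Fin k → E),
    (∀ i, lam i ∈ Set.Ioo (0 : ℝ) 1) ∧
    B ⊆ (⋃ i, x i +ᵥ lam i • B) ∧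
    s = ∑ i, lam i ^ α}

/-- `gCovDim α d` is the infimum of `gCov α B` over all convex bodies `B ⊆ ℝ^d`. -/
noncomputable def gCovDim (α : ℝ) (d : ℕ) : ℝ :=
  sInf {g : ℝ | ∃ B : Set (EuclideanSpace ℝ (Fin d)), IsConvexBody B ∧ g = gCov α B}

/-- A covering of a compact set with nonempty interior by its homothets has total relative
volume at least one. -/
theorem one_le_sum_pow_finrank_of_subset_iUnion {F ι : Type*} [NormedAddCommGroup F]
    [NormedSpace ℝ F] [FiniteDimensional ℝ F] {A : Set F} (hA : IsCompact A)
    (hA' : (interior A).Nonempty) (t : Finset ι) (lam : ι → ℝ) (x : ι → F)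
    (hlam : ∀ i, 0 ≤ lam i) (hcov : A ⊆ ⋃ i ∈ t, x i +ᵥ lam i • A) :
    1 ≤ ∑ i ∈ t, lam i ^ Module.finrank ℝ F := by
  borelize F
  let μ : Measure F := Measure.addHaar
  have hpos : 0 < μ A := (isOpen_interior.measure_pos μ hA').trans_le (measure_mono interior_subset)
  have hfin : μ A ≠ ⊤ := hA.measure_lt_top.ne
  have hle : μ A ≤ ENNReal.ofReal (∑ i ∈ t, lam i ^ Module.finrank ℝ F) * μ A := by
    calc μ A ≤ μ (⋃ i ∈ t, x i +ᵥ lam i • A) := measure_mono hcov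
      _ ≤ ∑ i ∈ t, μ (x i +ᵥ lam i • A) := measure_biUnion_finset_le _ _
      _ = ∑ i ∈ t, ENNReal.ofReal (lam i ^ Module.finrank ℝ F) * μ A := by
          refine Finset.sum_congr rfl fun i _ => ?_
          rw [measure_vadd, Measure.addHaar_smul_of_nonneg μ (hlam i)]
      _ = _ := by
          rw [← Finset.sum_mul, ENNReal.ofReal_sum_of_nonneg fun i _ => pow_nonneg (hlam i) _]
  by_contra! h
  have hlt : ENNReal.ofReal (∑ i ∈ t, lam i ^ Module.finrank ℝ F) < 1 :=
    ENNReal.ofReal_lt_one.2 h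
  have := ENNReal.mul_lt_mul_left hpos.ne' hfin hlt
  rw [one_mul] at this
  exact absurd hle this.not_ge

/-- Given at most `d` points in dimension `d`, some functional is strictly larger at some point of
a prescribed set with nonempty interior than at each of the given points. -/
theorem exists_dual_pos_of_card_le {E ι : Type*} [NormedAddCommGroup E] [NormedSpace ℝ E]
    [FiniteDimensional ℝ E] {B : Set E} (hB : (interior B).Nonempty) (s : Finset ι)
    (hs : s.card ≤ Module.finrank ℝ E) (c : ι → E) :
    ∃ z ∈ B, ∃ f : E →L[ℝ] ℝ, ∀ i ∈ s, 0 < f (z - c i) := by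
  classical
  obtain ⟨z₀, hz₀⟩ := hB
  rcases s.eq_empty_or_nonempty with rfl | ⟨j, hj⟩
  · exact ⟨z₀, interior_subset hz₀, 0, by simp⟩
  let W := Submodule.span ℝ (((s.erase j).image fun i => c i - c j : Finset E) : Set E)
  have hW : W < ⊤ := by
    refine Submodule.lt_top_of_finrank_lt_finrank ?_
    calc Module.finrank ℝ W ≤ ((s.erase j).image fun i => c i - c j).card :=
          finrank_span_finset_le_card _
      _ ≤ (s.erase j).card := Finset.card_image_le
      _ < s.card := Finset.card_erase_lt_of_mem hj
      _ ≤ _ := hs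
  obtain ⟨f, hf, hfW⟩ := Submodule.exists_le_ker_of_lt_top W hW
  have hconst : ∀ i ∈ s, f (c i) = f (c j) := by
    intro i hi
    by_cases hij : i = j
    · rw [hij]
    have : c i - c j ∈ W := Submodule.subset_span (by
      simp only [Finset.coe_image, Set.mem_image, Finset.mem_coe, Finset.mem_erase]
      exact ⟨i, ⟨hij, hi⟩, rfl⟩)
    have := hfW this
    rwa [LinearMap.mem_ker, map_sub, sub_eq_zero] at this
  obtain ⟨z, hz, hfz⟩ : ∃ z ∈ B, f z ≠ f (c j) := by
    by_contra! h
    apply hf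
    have hsub : interior B ⊆ (fun x => x - z₀) ⁻¹' (LinearMap.ker f : Set E) := by
      intro x hx
      simp [h x (interior_subset hx), h z₀ (interior_subset hz₀)]
    have hker : LinearMap.ker f = ⊤ := by
      refine Submodule.eq_top_of_nonempty_interior' _ ⟨0, ?_⟩
      refine mem_interior.2 ⟨(fun x => x + z₀) ⁻¹' interior B, fun x hx => ?_,
        isOpen_interior.preimage (by fun_prop), by simpa using hz₀⟩
      simpa using hsub hx
    exact LinearMap.ker_eq_top.1 hker
  rcases lt_or_gt_of_ne hfz with h | h
  · refine ⟨z, hz, -LinearMap.toContinuousLinearMap f, fun i hi => ?_⟩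
    simp [hconst i hi, h]
  · refine ⟨z, hz, LinearMap.toContinuousLinearMap f, fun i hi => ?_⟩
    simp [hconst i hi, h]

/-- Discarding `s.card ≤ d` members of a covering of a convex body in dimension `d` by smaller
homothets leaves members whose `(d - s.card)`-th powers of ratios sum to at least one. -/
theorem one_le_sum_compl_pow {E ι : Type*} [NormedAddCommGroup E] [InnerProductSpace ℝ E]
    [FiniteDimensional ℝ E] [Fintype ι] [DecidableEq ι] {B : Set E} (hB : IsConvexBody B)
    (lam : ι → ℝ) (x : ι → E) (hlam : ∀ i, lam i ∈ Set.Ioo (0 : ℝ) 1)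
    (hcov : B ⊆ ⋃ i, x i +ᵥ lam i • B) (s : Finset ι) (hs : s.card ≤ Module.finrank ℝ E) :
    1 ≤ ∑ i ∈ sᶜ, lam i ^ (Module.finrank ℝ E - s.card) := by
  classical
  obtain ⟨hconv, hcomp, hint⟩ := hB
  obtain ⟨z, hz, f, hf⟩ := exists_dual_pos_of_card_le hint s hs fun i => (1 - lam i)⁻¹ • x i
  have hf' : ∀ i ∈ s, 0 < f ((1 - lam i) • z - x i) := by
    intro i hi
    have h1 : 0 < 1 - lam i := sub_pos.2 (hlam i).2
    have : (1 - lam i) • z - x i = (1 - lam i) • (z - (1 - lam i)⁻¹ • x i) := by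
      rw [smul_sub, smul_inv_smul₀ h1.ne']
    rw [this, map_smul]
    exact mul_pos h1 (hf i hi)
  let W := Submodule.span ℝ ((s.image fun i => (1 - lam i) • z - x i : Finset E) : Set E)
  have hWmem : ∀ i ∈ s, (1 - lam i) • z - x i ∈ W := fun i hi =>
    Submodule.subset_span (by
      simp only [Finset.coe_image, Set.mem_image, Finset.mem_coe]
      exact ⟨i, hi, rfl⟩)
  have hWrank : Module.finrank ℝ W ≤ s.card :=
    (finrank_span_finset_le_card _).trans Finset.card_image_le
  let π : E →L[ℝ] Wᗮ := Wᗮ.orthogonalProjectionOnto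
  have hπW : ∀ w ∈ W, π w = 0 := fun w hw =>
    Submodule.orthogonalProjectionOnto_apply_of_mem_orthogonal
      (Submodule.le_orthogonal_orthogonal W hw)
  have hπsurj : Function.Surjective π := fun y =>
    ⟨y, Submodule.orthogonalProjectionOnto_mem_subspace_eq_self y⟩
  have hcov' : π '' B ⊆ ⋃ i ∈ sᶜ, π (x i) +ᵥ lam i • (π '' B) := by
    rintro _ ⟨q, hq, rfl⟩
    have hK : IsCompact (B ∩ π ⁻¹' {π q}) :=
      hcomp.inter_right (isClosed_singleton.preimage π.continuous)
    obtain ⟨p, ⟨hpB, hpq⟩, hmax⟩ := hK.exists_isMaxOn ⟨q, hq, rfl⟩ f.continuous.continuousOn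
    obtain ⟨i, hi⟩ := Set.mem_iUnion.1 (hcov hpB)
    obtain ⟨_, ⟨y, hy, rfl⟩, hyp⟩ := hi
    simp only [vadd_eq_add] at hyp
    have his : i ∉ s := by
      intro his
      have hp' : p + ((1 - lam i) • z - x i) = lam i • y + (1 - lam i) • z := by
        rw [← hyp]; abel
      have hmem : p + ((1 - lam i) • z - x i) ∈ B ∩ π ⁻¹' {π q} := by
        refine ⟨?_, ?_⟩
        · rw [hp']
          exact hconv hy hz (hlam i).1.le (sub_pos.2 (hlam i).2).le (by ring)
        · simp only [Set.mem_preimage, Set.mem_singleton_iff] at hpq ⊢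
          rw [map_add, hπW _ (hWmem i his), add_zero, hpq]
      have hle : f (p + ((1 - lam i) • z - x i)) ≤ f p := hmax hmem
      rw [map_add] at hle
      linarith [hf' i his]
    refine Set.mem_biUnion (by simpa using his) ?_
    have hpq' : π p = π q := hpq
    refine ⟨lam i • π y, ⟨π y, ⟨y, hy, rfl⟩, rfl⟩, ?_⟩
    simp only [vadd_eq_add]
    rw [← hpq', ← hyp, map_add, map_smul]
  have hint' : (interior (π '' B)).Nonempty :=
    (hint.image π).mono ((π.isOpenMap hπsurj).image_interior_subset B)
  refine (one_le_sum_pow_finrank_of_subset_iUnion (hcomp.image π.continuous) hint' sᶜ lam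
    (fun i => π (x i)) (fun i => (hlam i).1.le) hcov').trans ?_
  refine Finset.sum_le_sum fun i _ => pow_le_pow_of_le_one (hlam i).1.le (hlam i).2.le ?_
  have := W.finrank_add_finrank_orthogonal
  omega

/-- The bootstrapping inequality satisfied by `t - a * (log t)²`. -/
theorem log_sub_mul_log_sq_le {a n t : ℝ} (ha : 0 ≤ a) (hn : 1 ≤ n) (ht : t = n + a)
    (ht3 : 3 ≤ t) (hφ : 1 < t - a * Real.log t ^ 2) :
    Real.log (t - a * Real.log t ^ 2) ≤ n * (Real.log t ^ 2 - Real.log (t - 1) ^ 2) := by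
  have ht0 : 0 < t := by linarith
  have hL : 1 ≤ Real.log t := by
    rw [Real.le_log_iff_exp_le ht0]
    linarith [Real.exp_one_lt_d9]
  have hM : 0 ≤ Real.log (t - 1) := Real.log_nonneg (by linarith)
  set L := Real.log t with hLdef
  set M := Real.log (t - 1) with hMdef
  have hdiff : 1 / t ≤ L - M := by
    have h := Real.log_le_sub_one_of_pos (x := (t - 1) / t) (by apply div_pos <;> linarith)
    rw [Real.log_div (by linarith) ht0.ne'] at h
    have : (t - 1) / t - 1 = -(1 / t) := by field_simp; ring
    linarith
  have hlog : Real.log (t - a * L ^ 2) ≤ L - a * L ^ 2 / t := by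
    have h := Real.log_le_sub_one_of_pos (x := (t - a * L ^ 2) / t) (by
      apply div_pos <;> linarith)
    rw [Real.log_div (by linarith) ht0.ne'] at h
    have : (t - a * L ^ 2) / t - 1 = -(a * L ^ 2 / t) := by field_simp; ring
    linarith
  have hkey : L - a * L ^ 2 / t ≤ n * (1 / t * (L + M)) := by
    have h : t * L - a * L ^ 2 ≤ n * (L + M) := by
      have h1 : 0 ≤ n * M := by positivity
      have h2 : a * L ≤ a * L ^ 2 := mul_le_mul_of_nonneg_left (by nlinarith) ha
      rw [ht]
      nlinarith
    have h' := div_le_div_of_nonneg_right h ht0.le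
    have e1 : (t * L - a * L ^ 2) / t = L - a * L ^ 2 / t := by field_simp
    have e2 : n * (L + M) / t = n * (1 / t * (L + M)) := by field_simp
    rwa [e1, e2] at h'
  have hfac : 1 / t * (L + M) ≤ L ^ 2 - M ^ 2 := by
    have := mul_le_mul_of_nonneg_right hdiff (by linarith : 0 ≤ L + M)
    linarith [show (L - M) * (L + M) = L ^ 2 - M ^ 2 by ring]
  linarith [mul_le_mul_of_nonneg_left hfac (by linarith : 0 ≤ n)]

section Tail

variable {ι : Type*} [Fintype ι] [DecidableEq ι] {lam : ι → ℝ} {d a : ℕ}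

/-- Removing the largest remaining ratio `l` from a tail `∑ i ∈ sᶜ, lam i ^ a` of the sum. -/
theorem exists_tail_step (hlam : ∀ i, lam i ∈ Set.Ioo (0 : ℝ) 1)
    (H : ∀ s : Finset ι, s.card ≤ d → 1 ≤ ∑ i ∈ sᶜ, lam i ^ (d - s.card))
    {n : ℕ} {s : Finset ι} (hs : s.card + n + a = d) :
    ∃ s' : Finset ι, s'.card = s.card + 1 ∧ ∃ l ∈ Set.Ioo (0 : ℝ) 1,
      ∑ i ∈ sᶜ, lam i ^ a = l ^ a + ∑ i ∈ s'ᶜ, lam i ^ a ∧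
      1 ≤ l ^ n * ∑ i ∈ sᶜ, lam i ^ a := by
  have h1 := H s (by omega)
  have hne : sᶜ.Nonempty := by
    by_contra! h
    rw [h, Finset.sum_empty] at h1
    linarith
  obtain ⟨j, hj, hmax⟩ := sᶜ.exists_max_image lam hne
  have hjs : j ∉ s := by simpa using hj
  refine ⟨insert j s, Finset.card_insert_of_notMem hjs, lam j, hlam j, ?_, ?_⟩
  · rw [Finset.compl_insert, Finset.add_sum_erase _ (fun i => lam i ^ a) hj]
  · refine h1.trans ?_
    rw [Finset.mul_sum]
    refine Finset.sum_le_sum fun i hi => ?_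
    rw [show d - s.card = n + a by omega, pow_add]
    exact mul_le_mul_of_nonneg_right (pow_le_pow_left₀ (hlam i).1.le (hmax i hi) _)
      (pow_nonneg (hlam i).1.le _)

theorem one_le_tail (hlam : ∀ i, lam i ∈ Set.Ioo (0 : ℝ) 1)
    (H : ∀ s : Finset ι, s.card ≤ d → 1 ≤ ∑ i ∈ sᶜ, lam i ^ (d - s.card))
    {s : Finset ι} (hs : s.card + a ≤ d) : 1 ≤ ∑ i ∈ sᶜ, lam i ^ a :=
  (H s (by omega)).trans <| Finset.sum_le_sum fun i _ =>
    pow_le_pow_of_le_one (hlam i).1.le (hlam i).2.le (by omega)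

theorem le_tail (hlam : ∀ i, lam i ∈ Set.Ioo (0 : ℝ) 1)
    (H : ∀ s : Finset ι, s.card ≤ d → 1 ≤ ∑ i ∈ sᶜ, lam i ^ (d - s.card)) (ha : 1 ≤ a)
    (n : ℕ) (hna : 3 ≤ n + a) (s : Finset ι) (hs : s.card + n + a = d) :
    ((n + a : ℕ) : ℝ) - a * Real.log (n + a : ℕ) ^ 2 ≤ ∑ i ∈ sᶜ, lam i ^ a := by
  have hL : ∀ m : ℕ, 3 ≤ m → 1 ≤ Real.log m := by
    intro m hm
    have hm' : (3 : ℝ) ≤ m := by exact_mod_cast hm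
    rw [Real.le_log_iff_exp_le (by linarith)]
    linarith [Real.exp_one_lt_d9]
  induction n generalizing s with
  | zero =>
    have h1 := one_le_tail (a := a) hlam H (s := s) (by omega)
    rw [zero_add] at hna ⊢
    have ha0 : (0 : ℝ) ≤ a := Nat.cast_nonneg a
    nlinarith [hL a hna, mul_le_mul_of_nonneg_left (one_le_pow₀ (hL a hna) : _ ≤ _ ^ 2) ha0]
  | succ n ih =>
    have h1 := one_le_tail (a := a) hlam H (s := s) (by omega)
    by_contra! hlt
    obtain ⟨s', hs', l, hl, hsum, hpow⟩ := exists_tail_step (a := a) hlam H hs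
    set Q := ∑ i ∈ sᶜ, lam i ^ a with hQ
    set Q' := ∑ i ∈ s'ᶜ, lam i ^ a with hQ'
    have hL1 := hL _ hna
    by_cases hn : 3 ≤ n + a
    · have ih' := ih hn s' (by omega)
      rw [← hQ'] at ih'
      have hcast : ((n + 1 + a : ℕ) : ℝ) - 1 = (n + a : ℕ) := by push_cast; ring
      have hboot := log_sub_mul_log_sq_le (a := a) (n := n + 1) (t := (n + 1 + a : ℕ))
        (by positivity) (by norm_cast; omega) (by push_cast; ring) (by exact_mod_cast hna)
        (by linarith)
      rw [hcast] at hboot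
      have hlogQ : Real.log Q ≤ Real.log (((n + 1 + a : ℕ) : ℝ) -
          a * Real.log (n + 1 + a : ℕ) ^ 2) := Real.log_le_log (by linarith) hlt.le
      have hlogl : 0 ≤ (n + 1) * Real.log l + Real.log Q := by
        have h := Real.log_nonneg hpow
        rw [Real.log_mul (pow_pos hl.1 _).ne' (by linarith), Real.log_pow] at h
        exact_mod_cast h
      have hla : 1 + a * Real.log l ≤ l ^ a := by
        have h := Real.log_le_sub_one_of_pos (pow_pos hl.1 a)
        rw [Real.log_pow] at h
        linarith
      have hn0 : (0 : ℝ) < n + 1 := by positivity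
      have hD : Real.log (n + a : ℕ) ^ 2 - Real.log (n + 1 + a : ℕ) ^ 2 ≤ Real.log l := by
        nlinarith
      have := mul_le_mul_of_nonneg_left hD (Nat.cast_nonneg a : (0 : ℝ) ≤ a)
      push_cast at *
      nlinarith
    · have hcases : (a = 1 ∧ n = 1) ∨ (a = 2 ∧ n = 0) := by omega
      rcases hcases with ⟨rfl, rfl⟩ | ⟨rfl, rfl⟩
      · obtain ⟨s'', hs'', l', hl', hsum', hpow'⟩ :=
          exists_tail_step (a := 1) (n := 1) (s := s') hlam H (by omega)
        have h3 := one_le_tail (a := 1) hlam H (s := s'') (by omega)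
        rw [← hQ'] at hsum' hpow'
        rw [pow_one] at hsum hsum' hpow'
        have hQ2 : Q < 2 := by push_cast at *; nlinarith
        have hQ'_ge : 1.6 ≤ Q' := by
          by_contra! h
          nlinarith [hl'.1]
        have hlQ : 1 ≤ l * Q := hpow.trans (by
          refine mul_le_mul_of_nonneg_right ?_ (by linarith)
          have := hl.1
          have := hl.2
          simp only [Nat.reduceAdd]
          nlinarith)
        nlinarith [hl.1]
      · push_cast at *
        nlinarith

end Tail

/-- Every convex body admits a finite covering by homothets of ratio `1 / 2`. -/
theorem IsConvexBody.exists_covering {E : Type*} [NormedAddCommGroup E] [NormedSpace ℝ E]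
    {B : Set E} (hB : IsConvexBody B) :
    ∃ (k : ℕ) (lam : Fin k → ℝ) (x : Fin k → E),
      (∀ i, lam i ∈ Set.Ioo (0 : ℝ) 1) ∧ B ⊆ ⋃ i, x i +ᵥ lam i • B := by
  obtain ⟨-, hcomp, z, hz⟩ := hB
  have hopen : ∀ x : E, IsOpen (x +ᵥ (1 / 2 : ℝ) • interior B) := fun x =>
    (isOpen_interior.smul₀ (by norm_num)).vadd x
  obtain ⟨t, ht⟩ := hcomp.elim_finite_subcover _ hopen fun y _ =>
    Set.mem_iUnion.2 ⟨y - (1 / 2 : ℝ) • z, (1 / 2 : ℝ) • z, Set.smul_mem_smul_set hz, by simp⟩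
  refine ⟨t.card, fun _ => 1 / 2, fun i => t.equivFin.symm i, fun _ => by norm_num, ?_⟩
  intro y hy
  obtain ⟨x, hxt, hyx⟩ := Set.mem_iUnion₂.1 (ht hy)
  refine Set.mem_iUnion.2 ⟨t.equivFin ⟨x, hxt⟩, ?_⟩
  beta_reduce
  rw [Equiv.symm_apply_apply]
  exact Set.vadd_set_mono (Set.smul_set_mono interior_subset) hyx

/-- For `d ≥ 3` and `0 ≤ α ≤ d`: every translative covering of a convex body `B ⊆ ℝ^d` by
smaller homothets with coefficients `λᵢ ∈ (0,1)` satisfies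
`∑ λᵢ^α ≥ d - ⌈α⌉ (ln d)²`; in particular `g_α(d) ≥ d - ⌈α⌉ (ln d)²`. -/
theorem covering_sum_lower_bound (d : ℕ) (hd : 3 ≤ d) (α : ℝ) (hα : 0 ≤ α) (hαd : α ≤ d) :
    (∀ (B : Set (EuclideanSpace ℝ (Fin d))), IsConvexBody B →
      ∀ (k : ℕ) (lam : Fin k → ℝ) (x : Fin k → EuclideanSpace ℝ (Fin d)),
        (∀ i, lam i ∈ Set.Ioo (0 : ℝ) 1) →
        B ⊆ (⋃ i, x i +ᵥ lam i • B) →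
        (d : ℝ) - (⌈α⌉ : ℝ) * Real.log d ^ 2 ≤ ∑ i, lam i ^ α) ∧
    (d : ℝ) - (⌈α⌉ : ℝ) * Real.log d ^ 2 ≤ gCovDim α d := by
  have hmain : ∀ (B : Set (EuclideanSpace ℝ (Fin d))), IsConvexBody B →
      ∀ (k : ℕ) (lam : Fin k → ℝ) (x : Fin k → EuclideanSpace ℝ (Fin d)),
        (∀ i, lam i ∈ Set.Ioo (0 : ℝ) 1) →
        B ⊆ (⋃ i, x i +ᵥ lam i • B) →
        (d : ℝ) - (⌈α⌉ : ℝ) * Real.log d ^ 2 ≤ ∑ i, lam i ^ α := by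
    intro B hB k lam x hlam hcov
    have H : ∀ s : Finset (Fin k), s.card ≤ d → 1 ≤ ∑ i ∈ sᶜ, lam i ^ (d - s.card) := by
      intro s hs
      simpa using one_le_sum_compl_pow hB lam x hlam hcov s (by simpa using hs)
    have hceil : (⌈α⌉ : ℝ) = (⌈α⌉₊ : ℝ) := (natCast_ceil_eq_intCast_ceil hα).symm
    rw [hceil]
    have had : ⌈α⌉₊ ≤ d := Nat.ceil_le.2 hαd
    rcases Nat.eq_zero_or_pos ⌈α⌉₊ with h0 | hpos
    · have hα0 : α = 0 := le_antisymm (Nat.ceil_eq_zero.1 h0) hα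
      have hkd : d ≤ k := by
        by_contra! h
        have := H Finset.univ (by simpa using h.le)
        rw [Finset.compl_univ, Finset.sum_empty] at this
        linarith
      simpa [h0, hα0] using hkd
    · have h := le_tail (a := ⌈α⌉₊) hlam H hpos (d - ⌈α⌉₊) (by omega) ∅ (by simp; omega)
      rw [Nat.sub_add_cancel had, Finset.compl_empty] at h
      refine h.trans (Finset.sum_le_sum fun i _ => ?_)
      rw [← Real.rpow_natCast]
      exact Real.rpow_le_rpow_of_exponent_ge (hlam i).1 (hlam i).2.le (Nat.le_ceil α)
  refine ⟨hmain, le_csInf ?_ ?_⟩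
  · exact ⟨_, Metric.closedBall 0 1, ⟨convex_closedBall _ _, isCompact_closedBall _ _,
      (Metric.nonempty_ball.2 one_pos).mono Metric.ball_subset_interior_closedBall⟩, rfl⟩
  · rintro _ ⟨B, hB, rfl⟩
    refine le_csInf ?_ ?_
    · obtain ⟨k, lam, x, hlam, hcov⟩ := hB.exists_covering
      exact ⟨_, k, lam, x, hlam, hcov, rfl⟩
    · rintro _ ⟨k, lam, x, hlam, hcov, rfl⟩
      exact hmain B hB k lam x hlam hcov
end

section
/- For every integer d ≥ 3, every real α with 0 ≤ α ≤ d, every convex body B in ℝ^d, and every finite family λ_1,…,λ_k ∈ (0,1), x_1,…,x_k ∈ ℝ^d whose homothets cover the boundary of B, i.e. ∂B ⊆ ⋃_i (λ_i • B + x_i), one has ∑_{i=1}^k λ_i^α ≥ d − ⌈α⌉ (ln d)^2. -/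
open Set MeasureTheory Pointwise

section
variable {E : Type*} [NormedAddCommGroup E] [InnerProductSpace ℝ E]

theorem notMem_interior_of_isMaxOn {B : Set E} {V : Submodule ℝ E} {g y p q : E}
    (hgV : g ∈ V) (hg : g ≠ 0) (hmax : ∀ z ∈ B, z - y ∈ V → inner ℝ g z ≤ inner ℝ g p)
    (hqV : q - y ∈ V) (hq : inner ℝ g p ≤ inner ℝ g q) : q ∉ interior B := by
  intro hqi
  have hc : Filter.Tendsto (fun t : ℝ => q + t • g) (nhdsWithin 0 (Ioi 0)) (nhds q) := by
    have : ContinuousAt (fun t : ℝ => q + t • g) 0 := by fun_prop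
    have h2 := this.tendsto
    simp only [zero_smul, add_zero] at h2
    exact h2.mono_left nhdsWithin_le_nhds
  have h1 := hc.eventually (mem_interior_iff_mem_nhds.1 hqi)
  obtain ⟨t, htB, ht⟩ := (h1.and self_mem_nhdsWithin).exists
  have h3 := hmax _ htB (by
    have : q + t • g - y = (q - y) + t • g := by abel
    rw [this]
    exact V.add_mem hqV (V.smul_mem t hgV))
  rw [inner_add_right, inner_smul_right] at h3
  have h4 : 0 < inner ℝ g g := real_inner_self_pos.2 hg
  have h5 : (0 : ℝ) < t := ht
  nlinarith [mul_pos h5 h4]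

theorem exists_mem_frontier_notMem_homothets {ι : Type*} {B : Set E} (hconv : Convex ℝ B)
    (hcomp : IsCompact B) {o : E} (ho : o ∈ interior B) {V : Submodule ℝ E}
    (hVc : IsClosed (V : Set E)) {g : E}
    (hgV : g ∈ V) (hg : g ≠ 0) {I : Set ι} {lam : ι → ℝ} {x : ι → E}
    (hlam : ∀ i ∈ I, lam i ∈ Ioo (0 : ℝ) 1)
    (hV : ∀ i ∈ I, (1 - lam i)⁻¹ • x i - o ∈ V)
    (hneg : ∀ i ∈ I, inner ℝ g ((1 - lam i)⁻¹ • x i - o) ≤ 0) {y : E} (hy : y ∈ B) :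
    ∃ p ∈ frontier B, p - y ∈ V ∧ ∀ i ∈ I, p ∉ x i +ᵥ lam i • B := by
  have hK : IsCompact (B ∩ (fun z => z - y) ⁻¹' (V : Set E)) :=
    hcomp.inter_right (hVc.preimage (by fun_prop))
  obtain ⟨p, ⟨hpB, hpV⟩, hp⟩ := hK.exists_isMaxOn ⟨y, hy, by simp⟩
    (f := fun z => inner ℝ g z) (by fun_prop)
  have hmax : ∀ z ∈ B, z - y ∈ V → inner ℝ g z ≤ inner ℝ g p := fun z hz hzV => hp ⟨hz, hzV⟩
  refine ⟨p, ⟨subset_closure hpB, notMem_interior_of_isMaxOn hgV hg hmax hpV le_rfl⟩, hpV, ?_⟩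
  rintro i hi hpi
  obtain ⟨-, ⟨b, hb, rfl⟩, hbp⟩ := hpi
  simp only [vadd_eq_add] at hbp
  obtain ⟨h0, h1⟩ := hlam i hi
  have h1' : 0 < 1 - lam i := by linarith
  set v := (1 - lam i)⁻¹ • x i - o with hv
  have hx : x i = (1 - lam i) • (v + o) := by
    rw [hv, sub_add_cancel, smul_smul, mul_inv_cancel₀ h1'.ne', one_smul]
  have hq : p - (1 - lam i) • v = lam i • b + (1 - lam i) • o := by
    rw [← hbp, hx]; module
  refine notMem_interior_of_isMaxOn (q := p - (1 - lam i) • v) hgV hg hmax ?_ ?_ ?_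
  · have : p - (1 - lam i) • v - y = (p - y) - (1 - lam i) • v := by abel
    rw [this]
    exact V.sub_mem hpV (V.smul_mem _ (hV i hi))
  · rw [inner_sub_right, inner_smul_right]
    nlinarith [mul_nonneg h1'.le (neg_nonneg.2 (hneg i hi))]
  · rw [hq]
    exact hconv.combo_self_interior_mem_interior hb ho h0.le h1' (by ring)

variable [FiniteDimensional ℝ E]

theorem exists_mem_orthogonal_inner_nonpos (U : Submodule ℝ E)
    (hU : Module.finrank ℝ U < Module.finrank ℝ E) (v : E) :
    ∃ g : E, g ≠ 0 ∧ g ∈ Uᗮ ∧ v ∈ U ⊔ Submodule.span ℝ {g} ∧ inner ℝ g v ≤ 0 := by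
  obtain ⟨u, hu, w, hw, huw⟩ := Submodule.exists_add_mem_mem_orthogonal (K := U) v
  by_cases hw0 : w = 0
  · have : Uᗮ ≠ ⊥ := by
      intro h
      have := U.finrank_add_finrank_orthogonal
      rw [h, finrank_bot] at this
      omega
    obtain ⟨g, hgU, hg⟩ := Uᗮ.ne_bot_iff.1 this
    have hvu : v = u := by rw [huw, hw0, add_zero]
    exact ⟨g, hg, hgU, hvu ▸ Submodule.mem_sup_left hu,
      by rw [hvu, Submodule.inner_left_of_mem_orthogonal hu hgU]⟩
  · refine ⟨-w, neg_ne_zero.2 hw0, Uᗮ.neg_mem hw, ?_, ?_⟩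
    · rw [huw]
      refine Submodule.add_mem_sup hu (Submodule.mem_span_singleton.2 ⟨-1, by simp⟩)
    · rw [huw, inner_add_right, inner_neg_left, inner_neg_left,
        Submodule.inner_left_of_mem_orthogonal hu hw]
      simp [-inner_self_eq_norm_sq_to_K, real_inner_self_nonneg]

theorem exists_submodule_inner_nonpos {ι : Type*} [DecidableEq ι] (I : Finset ι) (v : ι → E)
    {m : ℕ} (hm : 1 ≤ m) (hI : I.card ≤ m) (hmE : m ≤ Module.finrank ℝ E) :
    ∃ (V : Submodule ℝ E) (g : E), Module.finrank ℝ V ≤ m ∧ g ∈ V ∧ g ≠ 0 ∧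
      ∀ i ∈ I, v i ∈ V ∧ inner ℝ g (v i) ≤ 0 := by
  classical
  obtain ⟨v₀, s, hs, hvs⟩ : ∃ (v₀ : E) (s : Finset E), s.card + 1 ≤ m ∧
      ∀ i ∈ I, v i = v₀ ∨ v i - v₀ ∈ s := by
    rcases I.eq_empty_or_nonempty with rfl | ⟨i₀, hi₀⟩
    · exact ⟨0, ∅, by simpa using hm, by simp⟩
    · refine ⟨v i₀, (I.erase i₀).image (fun i => v i - v i₀), ?_, fun i hi => ?_⟩
      · have h1 := Finset.card_image_le (s := I.erase i₀) (f := fun i => v i - v i₀)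
        have h2 := Finset.card_erase_add_one hi₀
        omega
      · by_cases h : i = i₀
        · exact Or.inl (by rw [h])
        · exact Or.inr (Finset.mem_image_of_mem _ (Finset.mem_erase.2 ⟨h, hi⟩))
  set U := Submodule.span ℝ (s : Set E)
  have hUcard : Module.finrank ℝ U ≤ s.card := finrank_span_finset_le_card s
  obtain ⟨g, hg, hgU, hv₀, hneg⟩ := exists_mem_orthogonal_inner_nonpos U (by omega) v₀
  have hdiff : ∀ i ∈ I, v i - v₀ ∈ U := by
    intro i hi
    rcases hvs i hi with h | h
    · rw [h, sub_self]; exact U.zero_mem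
    · exact Submodule.subset_span h
  refine ⟨U ⊔ Submodule.span ℝ {g}, g, ?_, ?_, hg, fun i hi => ?_⟩
  · have h1 := Submodule.finrank_add_le_finrank_add_finrank U (Submodule.span ℝ {g})
    rw [finrank_span_singleton hg] at h1
    omega
  · exact Submodule.mem_sup_right (Submodule.mem_span_singleton_self g)
  · have h : v i = (v i - v₀) + v₀ := by abel
    rw [h]
    refine ⟨Submodule.add_mem _ (Submodule.mem_sup_left (hdiff i hi)) hv₀, ?_⟩
    rw [inner_add_right, Submodule.inner_left_of_mem_orthogonal (hdiff i hi) hgU, zero_add]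
    exact hneg

theorem one_le_sum_pow_finrank_of_subset [MeasurableSpace E] [BorelSpace E] {ι : Type*}
    {s : Finset ι} {lam : ι → ℝ} {x : ι → E} {A : Set E} (hA : IsCompact A)
    (hAi : (interior A).Nonempty) (hlam : ∀ i ∈ s, 0 ≤ lam i)
    (hsub : A ⊆ ⋃ i ∈ s, x i +ᵥ lam i • A) :
    1 ≤ ∑ i ∈ s, lam i ^ Module.finrank ℝ E := by
  have h0 : volume A ≠ 0 := (Measure.measure_pos_of_nonempty_interior _ hAi).ne'
  have htop : volume A ≠ ⊤ := hA.measure_lt_top.ne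
  have h : volume A ≤ ENNReal.ofReal (∑ i ∈ s, lam i ^ Module.finrank ℝ E) * volume A := by
    calc volume A ≤ volume (⋃ i ∈ s, x i +ᵥ lam i • A) := measure_mono hsub
      _ ≤ ∑ i ∈ s, volume (x i +ᵥ lam i • A) := measure_biUnion_finset_le _ _
      _ = ∑ i ∈ s, ENNReal.ofReal (lam i ^ Module.finrank ℝ E) * volume A := by
        refine Finset.sum_congr rfl fun i hi => ?_
        rw [measure_vadd, Measure.addHaar_smul, abs_of_nonneg (pow_nonneg (hlam i hi) _)]
      _ = _ := by
        rw [← Finset.sum_mul, ENNReal.ofReal_sum_of_nonneg]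
        exact fun i hi => pow_nonneg (hlam i hi) _
  have h2 : 1 ≤ ENNReal.ofReal (∑ i ∈ s, lam i ^ Module.finrank ℝ E) := by
    by_contra! hlt
    have := ENNReal.mul_lt_mul_left h0 htop hlt
    rw [one_mul] at this
    exact absurd h this.not_ge
  exact ENNReal.one_le_ofReal.1 h2

theorem one_le_sum_compl_pow_s7 {ι : Type*} [Fintype ι] [DecidableEq ι] {B : Set E}
    (hB : Convex ℝ B) (hcomp : IsCompact B) (hint : (interior B).Nonempty)
    {lam : ι → ℝ} {x : ι → E} (hlam : ∀ i, lam i ∈ Ioo (0 : ℝ) 1)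
    (hcover : frontier B ⊆ ⋃ i, x i +ᵥ lam i • B) (I : Finset ι)
    {m : ℕ} (hm : 1 ≤ m) (hI : I.card ≤ m) (hmE : m ≤ Module.finrank ℝ E) :
    1 ≤ ∑ i ∈ Iᶜ, lam i ^ (Module.finrank ℝ E - m) := by
  obtain ⟨o, ho⟩ := hint
  obtain ⟨V, g, hVm, hgV, hg, hI⟩ :=
    exists_submodule_inner_nonpos I (fun i => (1 - lam i)⁻¹ • x i - o) hm hI hmE
  let _ : MeasurableSpace Vᗮ := borel _
  have : BorelSpace Vᗮ := ⟨rfl⟩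
  set π : E →L[ℝ] Vᗮ := Vᗮ.orthogonalProjectionOnto
  have hsurj : Function.Surjective π := fun z =>
    ⟨z, Submodule.orthogonalProjectionOnto_mem_subspace_eq_self z⟩
  have hker : ∀ z ∈ V, π z = 0 := fun z hz =>
    Submodule.orthogonalProjectionOnto_eq_zero_iff.2
      (by rwa [Submodule.orthogonal_orthogonal])
  have h := one_le_sum_pow_finrank_of_subset (s := Iᶜ) (lam := lam) (x := fun i => π (x i))
    (A := π '' B) (hcomp.image π.continuous)
    ((Set.Nonempty.image π ⟨o, ho⟩).mono
      (interior_maximal (image_mono interior_subset)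
        (π.isOpenMap hsurj _ isOpen_interior)))
    (fun i _ => (hlam i).1.le) (by
      rintro _ ⟨y, hy, rfl⟩
      obtain ⟨p, hpf, hpy, hpI⟩ := exists_mem_frontier_notMem_homothets (I := (I : Set ι)) hB hcomp
        ho V.closed_of_finiteDimensional hgV hg (fun i _ => hlam i) (fun i hi => (hI i hi).1)
        (fun i hi => (hI i hi).2) hy
      obtain ⟨i, hi⟩ := mem_iUnion.1 (hcover hpf)
      have hiI : i ∈ Iᶜ := Finset.mem_compl.2 fun h => hpI i h hi
      refine mem_iUnion₂.2 ⟨i, hiI, ?_⟩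
      obtain ⟨-, ⟨b, hb, rfl⟩, hbp⟩ := hi
      refine ⟨lam i • π b, ⟨π b, ⟨b, hb, rfl⟩, rfl⟩, ?_⟩
      have h1 : π y = π p := by
        have := hker _ hpy
        rw [map_sub, sub_eq_zero] at this
        exact this.symm
      rw [h1, ← hbp]
      simp)
  refine h.trans (Finset.sum_le_sum fun i _ => ?_)
  refine pow_le_pow_of_le_one (hlam i).1.le (hlam i).2.le ?_
  have := V.finrank_add_finrank_orthogonal
  omega
end

theorem one_lt_log_natCast {n : ℕ} (hn : 3 ≤ n) : 1 < Real.log n := by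
  rw [Real.lt_log_iff_exp_lt (by positivity)]
  have : (3 : ℝ) ≤ n := by exact_mod_cast hn
  linarith [Real.exp_one_lt_three]

theorem three_halves_le_log_natCast {n : ℕ} (hn : 5 ≤ n) : 3 / 2 ≤ Real.log n := by
  have h25 : (3 : ℝ) ≤ Real.log (5 ^ 2) := by
    rw [Real.le_log_iff_exp_le (by positivity)]
    have := Real.exp_one_lt_d9
    calc Real.exp 3 = Real.exp 1 ^ 3 := by rw [← Real.exp_nat_mul]; norm_num
      _ ≤ 2.7182818286 ^ 3 := by gcongr
      _ ≤ 5 ^ 2 := by norm_num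
  rw [Real.log_pow] at h25
  have h5 : Real.log 5 ≤ Real.log n := Real.log_le_log (by norm_num) (by exact_mod_cast hn)
  push_cast at h25
  linarith

theorem one_sub_le_pow_of_inv_le {a n : ℕ} (ha : 1 ≤ a) (hn : 2 * a + 1 ≤ n) {t : ℝ} (ht : 0 < t)
    (h : (n : ℝ)⁻¹ ≤ t ^ (n - a)) :
    1 - a * (Real.log (n + 1) ^ 2 - Real.log n ^ 2) ≤ t ^ a := by
  have ha' : (1 : ℝ) ≤ a := by exact_mod_cast ha
  have hn' : 2 * (a : ℝ) + 1 ≤ n := by exact_mod_cast hn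
  have hn0 : (0 : ℝ) < n := by linarith
  have hL : 0 ≤ Real.log n := Real.log_nonneg (by linarith)
  have h1 : -Real.log n ≤ (n - a) * Real.log t := by
    have := Real.log_le_log (by positivity) h
    rw [Real.log_inv, Real.log_pow, Nat.cast_sub (by omega)] at this
    exact this
  have h2 : 1 / ((n : ℝ) + 1) ≤ Real.log (n + 1) - Real.log n := by
    rw [← Real.log_div (by positivity) (by positivity)]
    refine le_trans (le_of_eq ?_) (Real.one_sub_inv_le_log_of_pos (by positivity))
    field_simp
    ring
  have h3 : 2 * Real.log n / (n + 1) ≤ Real.log (n + 1) ^ 2 - Real.log n ^ 2 := by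
    have h4 : Real.log n ≤ Real.log (n + 1) := Real.log_le_log hn0 (by linarith)
    calc 2 * Real.log n / (n + 1) = 1 / ((n : ℝ) + 1) * (2 * Real.log n) := by ring
      _ ≤ (Real.log (n + 1) - Real.log n) * (Real.log (n + 1) + Real.log n) :=
        mul_le_mul h2 (by linarith) (by linarith) (by linarith)
      _ = _ := by ring
  have h5 : -(2 * Real.log n / (n + 1)) ≤ Real.log t := by
    rw [← neg_div, div_le_iff₀ (by positivity)]
    rcases le_or_gt 0 (Real.log t) with h0 | h0
    · nlinarith
    · nlinarith
  have h6 := Real.add_one_le_exp (a * Real.log t)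
  rw [← Real.log_pow, Real.exp_log (by positivity), Real.log_pow] at h6
  nlinarith

/-- Either a whole sum of `a`-th powers is large, or one of the terms is. -/
theorem exists_inv_le_pow {ι : Type*} {s : Finset ι} {lam : ι → ℝ} (hlam : ∀ i, lam i ∈ Ioo (0 : ℝ) 1)
    {a n : ℕ} (hn : 1 ≤ n) (han : a ≤ n) (hs : 1 ≤ ∑ i ∈ s, lam i ^ n)
    (hsum : ∑ i ∈ s, lam i ^ a < n) : ∃ i ∈ s, (n : ℝ)⁻¹ ≤ lam i ^ (n - a) := by
  by_contra! hcon
  have hn0 : (0 : ℝ) < n := by exact_mod_cast hn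
  have h : ∑ i ∈ s, lam i ^ n ≤ ∑ i ∈ s, (n : ℝ)⁻¹ * lam i ^ a := by
    refine Finset.sum_le_sum fun i hi => ?_
    rw [← Nat.sub_add_cancel han, pow_add, Nat.sub_add_cancel han]
    exact mul_le_mul_of_nonneg_right (hcon i hi).le (pow_nonneg (hlam i).1.le _)
  rw [← Finset.mul_sum] at h
  have : (n : ℝ)⁻¹ * ∑ i ∈ s, lam i ^ a < (n : ℝ)⁻¹ * n :=
    mul_lt_mul_of_pos_left hsum (by positivity)
  rw [inv_mul_cancel₀ hn0.ne'] at this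
  linarith

section
variable {ι : Type*} [Fintype ι] [DecidableEq ι]

theorem exists_finset_le_sum_pow {d a : ℕ} (ha : 1 ≤ a) {lam : ι → ℝ}
    (hlam : ∀ i, lam i ∈ Ioo (0 : ℝ) 1)
    (hcompl : ∀ (I : Finset ι) (m : ℕ), 1 ≤ m → m ≤ d → I.card ≤ m →
      1 ≤ ∑ i ∈ Iᶜ, lam i ^ (d - m))
    (hsum : ∑ i, lam i ^ a < d - a * Real.log d ^ 2) {b : ℝ} (hb : 0 ≤ b) {i₀ : ι}
    (hi₀ : b ≤ lam i₀ ^ a) (m : ℕ) (hm : m + 1 + 2 * a ≤ d) :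
    ∃ I : Finset ι, I.card = m + 1 ∧
      b + m - a * (Real.log d ^ 2 - Real.log (d - m : ℕ) ^ 2) ≤ ∑ i ∈ I, lam i ^ a := by
  induction m with
  | zero => exact ⟨{i₀}, by simp, by simpa using hi₀⟩
  | succ m ih =>
    obtain ⟨I, hIcard, hI⟩ := ih (by omega)
    obtain ⟨n, hn⟩ : ∃ n, d = n + (m + 1) := ⟨d - (m + 1), by omega⟩
    have hna : 2 * a + 1 ≤ n := by omega
    have hdm : d - m = n + 1 := by omega
    have hdm' : d - (m + 1) = n := by omega
    have hdc : (d : ℝ) = n + (m + 1) := by rw [hn]; push_cast; ring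
    have hsplit := Finset.sum_add_sum_compl I (fun i => lam i ^ a)
    have hK := hcompl I (m + 1) (by omega) (by omega) hIcard.le
    rw [hdm'] at hK
    rw [hdm] at hI
    rw [hdm']
    have hlog := one_lt_log_natCast (n := n + 1) (by omega)
    have ha' : (1 : ℝ) ≤ a := by exact_mod_cast ha
    obtain ⟨i, hiI, hi⟩ := exists_inv_le_pow hlam (s := Iᶜ) (a := a) (n := n) (by omega) (by omega)
      hK (by
        have : 1 ≤ (a : ℝ) * Real.log (n + 1 : ℕ) ^ 2 := by nlinarith
        linarith)
    have h := one_sub_le_pow_of_inv_le ha hna (hlam i).1 hi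
    refine ⟨insert i I, ?_, ?_⟩
    · rw [Finset.card_insert_of_notMem (Finset.mem_compl.1 hiI), hIcard]
    · rw [Finset.sum_insert (Finset.mem_compl.1 hiI)]
      push_cast at hI ⊢
      linarith

theorem le_sum_pow_of_two_mul_lt {d a : ℕ} (ha : 1 ≤ a) (had : 2 * a + 1 ≤ d) {lam : ι → ℝ}
    (hlam : ∀ i, lam i ∈ Ioo (0 : ℝ) 1)
    (hcompl : ∀ (I : Finset ι) (m : ℕ), 1 ≤ m → m ≤ d → I.card ≤ m →
      1 ≤ ∑ i ∈ Iᶜ, lam i ^ (d - m)) :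
    (d : ℝ) - a * Real.log d ^ 2 ≤ ∑ i, lam i ^ a := by
  by_contra! hsum
  have hlogd := one_lt_log_natCast (n := d) (by omega)
  have ha' : (1 : ℝ) ≤ a := by exact_mod_cast ha
  obtain ⟨m, hm⟩ : ∃ m, d = m + 1 + 2 * a := ⟨d - (2 * a + 1), by omega⟩
  have hdc : (d : ℝ) = m + 1 + 2 * a := by rw [hm]; push_cast; ring
  have hdm : d - m = 2 * a + 1 := by omega
  have hdm' : d - (m + 1) = 2 * a := by omega
  have h1 := hcompl ∅ 1 le_rfl (by omega) (by simp)
  rw [Finset.compl_empty] at h1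
  obtain ⟨i₀, -, hi₀⟩ := exists_inv_le_pow hlam (s := Finset.univ) (a := a) (n := d - 1) (by omega)
    (by omega) h1 (by
      rw [Nat.cast_sub (by omega)]
      push_cast
      nlinarith)
  rcases eq_or_lt_of_le ha with rfl | ha2
  · have hhalf : (1 / 2 : ℝ) ≤ lam i₀ ^ 1 := by
      rw [pow_one]
      by_contra! hlt
      have h2 : lam i₀ ^ (d - 1 - 1) < (1 / 2 : ℝ) ^ (d - 1 - 1) :=
        pow_lt_pow_left₀ hlt (hlam i₀).1.le (by omega)
      have h3 : (1 / 2 : ℝ) ^ (d - 1 - 1) ≤ ((d - 1 : ℕ) : ℝ)⁻¹ := by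
        rw [one_div, inv_pow]
        refine inv_anti₀ (by exact_mod_cast (by omega : 0 < d - 1)) ?_
        have := Nat.lt_two_pow_self (n := d - 1 - 1)
        exact_mod_cast (by omega : d - 1 ≤ 2 ^ (d - 1 - 1))
      linarith
    obtain ⟨I, hIcard, hI⟩ := exists_finset_le_sum_pow le_rfl hlam hcompl hsum (by norm_num)
      hhalf m (by omega)
    have hsplit := Finset.sum_add_sum_compl I (fun i => lam i ^ 1)
    have hK := hcompl I (m + 1) (by omega) (by omega) hIcard.le
    rw [hdm'] at hK
    rw [hdm] at hI
    have hlog := one_lt_log_natCast (n := 2 * 1 + 1) (by omega)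
    have hrest : (3 / 2 : ℝ) ≤ ∑ i ∈ Iᶜ, lam i ^ 1 := by
      by_contra! hlt
      obtain ⟨i, hiI, hi⟩ := exists_inv_le_pow hlam (s := Iᶜ) (a := 1) (n := 2 * 1) (by omega)
        (by omega) hK (by push_cast; linarith)
      have hiI' := Finset.mem_compl.1 hiI
      have h4 := hcompl (insert i I) (m + 2) (by omega) (by omega)
        (by rw [Finset.card_insert_of_notMem hiI', hIcard])
      rw [show d - (m + 2) = 1 by omega, Finset.compl_insert] at h4
      have h5 := Finset.add_sum_erase _ (fun i => lam i ^ 1) hiI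
      norm_num at hi h4 h5 hlt
      linarith
    push_cast at *
    nlinarith
  · obtain ⟨I, hIcard, hI⟩ := exists_finset_le_sum_pow ha hlam hcompl hsum le_rfl
      (pow_nonneg (hlam i₀).1.le a) m (by omega)
    have hsplit := Finset.sum_add_sum_compl I (fun i => lam i ^ a)
    have hK := hcompl I (m + 1) (by omega) (by omega) hIcard.le
    rw [hdm'] at hK
    rw [hdm] at hI
    have hrest : 1 ≤ ∑ i ∈ Iᶜ, lam i ^ a := hK.trans (Finset.sum_le_sum fun i _ =>
      pow_le_pow_of_le_one (hlam i).1.le (hlam i).2.le (by omega))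
    have hlog := three_halves_le_log_natCast (n := 2 * a + 1) (by omega)
    have : 2 ≤ Real.log (2 * a + 1 : ℕ) ^ 2 := by nlinarith
    nlinarith

theorem le_sum_pow_of_le_two_mul {d a : ℕ} (hd : 3 ≤ d) (had : a ≤ d) (hda : d ≤ 2 * a)
    {lam : ι → ℝ} (hlam : ∀ i, lam i ∈ Ioo (0 : ℝ) 1)
    (hcompl : ∀ (I : Finset ι) (m : ℕ), 1 ≤ m → m ≤ d → I.card ≤ m →
      1 ≤ ∑ i ∈ Iᶜ, lam i ^ (d - m)) :
    (d : ℝ) - a * Real.log d ^ 2 ≤ ∑ i, lam i ^ a := by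
  have hlogd := one_lt_log_natCast hd
  have hnonneg : 0 ≤ ∑ i, lam i ^ a := Finset.sum_nonneg fun i _ => pow_nonneg (hlam i).1.le a
  have hd' : (3 : ℝ) ≤ d := by exact_mod_cast hd
  rcases eq_or_lt_of_le had with rfl | had'
  · have : 1 ≤ Real.log a ^ 2 := by nlinarith
    nlinarith
  have hone : 1 ≤ ∑ i, lam i ^ a := by
    have h1 := hcompl ∅ 1 le_rfl (by omega) (by simp)
    rw [Finset.compl_empty] at h1
    exact h1.trans (Finset.sum_le_sum fun i _ =>
      pow_le_pow_of_le_one (hlam i).1.le (hlam i).2.le (by omega))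
  have hda' : (d : ℝ) ≤ 2 * a := by exact_mod_cast hda
  rcases eq_or_lt_of_le hd with rfl | hd4
  · have : (2 : ℝ) ≤ a := by exact_mod_cast (by omega : 2 ≤ a)
    push_cast at *
    nlinarith
  · have h4 : 2 * Real.log 2 ≤ Real.log d := by
      rw [show 2 * Real.log 2 = Real.log (2 ^ 2) by rw [Real.log_pow]; norm_num]
      exact Real.log_le_log (by norm_num) (by norm_num; exact_mod_cast hd4)
    have h2 := Real.log_two_gt_d9
    have h5 : (3 / 2 : ℝ) ≤ Real.log d ^ 2 := by nlinarith
    have h6 : (2 : ℝ) ≤ a := by exact_mod_cast (by omega : 2 ≤ a)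
    rcases eq_or_lt_of_le (show 4 ≤ d from hd4) with rfl | hd5
    · push_cast at *
      nlinarith
    · have h7 := three_halves_le_log_natCast hd5
      have h8 : 2 ≤ Real.log d ^ 2 := by nlinarith
      nlinarith
end

/-- For `d ≥ 3`, `0 ≤ α ≤ d`, a convex body `B ⊆ ℝ^d`, and any finite family of smaller
homothets of `B` covering the boundary `∂B`, the sum of the `α`-th powers of the homothety
coefficients is at least `d - ⌈α⌉ (ln d)²`. -/
theorem boundary_covering_sum_lower_bound (d : ℕ) (hd : 3 ≤ d)
    (α : ℝ) (hα : 0 ≤ α) (hαd : α ≤ d)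
    (B : Set (EuclideanSpace ℝ (Fin d))) (hB : IsConvexBody B)
    (k : ℕ) (lam : Fin k → ℝ) (x : Fin k → EuclideanSpace ℝ (Fin d))
    (hlam : ∀ i, lam i ∈ Set.Ioo (0 : ℝ) 1)
    (hcover : frontier B ⊆ ⋃ i, x i +ᵥ lam i • B) :
    (d : ℝ) - (⌈α⌉ : ℝ) * Real.log d ^ 2 ≤ ∑ i, lam i ^ α := by
  have hcompl : ∀ (I : Finset (Fin k)) (m : ℕ), 1 ≤ m → m ≤ d → I.card ≤ m →
      1 ≤ ∑ i ∈ Iᶜ, lam i ^ (d - m) := by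
    intro I m hm hmd hI
    have h := one_le_sum_compl_pow_s7 hB.1 hB.2.1 hB.2.2 hlam hcover I hm hI (by simpa using hmd)
    simpa using h
  obtain ⟨a, ha⟩ : ∃ a : ℕ, ⌈α⌉ = a := ⟨⌈α⌉.toNat, (Int.toNat_of_nonneg (Int.ceil_nonneg hα)).symm⟩
  have hαa : α ≤ a := by
    have := Int.le_ceil α
    rw [ha] at this
    exact_mod_cast this
  have had : a ≤ d := by
    have : ⌈α⌉ ≤ (d : ℤ) := Int.ceil_le.2 (by exact_mod_cast hαd)
    rw [ha] at this
    exact_mod_cast this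
  have hle : ∑ i, lam i ^ a ≤ ∑ i, lam i ^ α := Finset.sum_le_sum fun i _ => by
    rw [← Real.rpow_natCast]
    exact Real.rpow_le_rpow_of_exponent_ge (hlam i).1 (hlam i).2.le hαa
  rw [ha, Int.cast_natCast]
  refine le_trans ?_ hle
  rcases Nat.eq_zero_or_pos a with rfl | ha0
  · have hk : d ≤ k := by
      by_contra! hlt
      have := hcompl Finset.univ d (by omega) le_rfl (by simpa using hlt.le)
      norm_num at this
    simpa using hk
  · rcases le_or_gt d (2 * a) with h | h
    · exact le_sum_pow_of_le_two_mul hd had h hlam hcompl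
    · exact le_sum_pow_of_two_mul_lt ha0 h hlam hcompl
end
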